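/- For an indecomposable module M over a Nakayama algebra without simple projectives, either pd M ≤ 1 and Ω²(M) = 0, or top Ω²(M) = γ(top M), where γS = τ soc P(S). -/

import Mathlib

universe u

variable (Λ : Type u) [Ring Λ]

section BasicDefs

variable (M : Type u) [AddCommGroup M] [Module Λ M]

/-- A module is uniserial if its submodules are linearly ordered by inclusion. -/
def IsUniserialMod : Prop := ∀ N N' : Submodule Λ M, N ≤ N' ∨ N' ≤ N

/-- A module is indecomposable if it is nonzero and admits no nontrivial direct sum
decomposition. -/
def IsIndecomposableMod : Prop :=
  Nontrivial M ∧ ∀ N N' : Submodule Λ M, IsCompl N N' → N = ⊥ ∨ N' = ⊥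

/-- The radical of a module: the intersection of all maximal submodules. -/
def modRadical : Submodule Λ M := sInf {N : Submodule Λ M | IsCoatom N}

/-- The socle of a module: the sum of all simple submodules. -/
def modSocle : Submodule Λ M := sSup {N : Submodule Λ M | IsAtom N}

/-- `HasLength Λ M n` : the module `M` has a composition series of length `n`. -/
def HasLength (n : ℕ) : Prop :=
  ∃ c : Fin (n + 1) → Submodule Λ M,
    c 0 = ⊥ ∧ c (Fin.last n) = ⊤ ∧ ∀ i : Fin n, c i.castSucc ⋖ c i.succ

end BasicDefs

/-- A Nakayama algebra: an artinian ring all of whose finite-length indecomposable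
(left) modules are uniserial. -/
class IsNakayama : Prop where
  artinian : IsArtinianRing Λ
  serial : ∀ (M : Type u) [AddCommGroup M] [Module Λ M],
    (∃ n, HasLength Λ M n) → IsIndecomposableMod Λ M → IsUniserialMod Λ M

/-- `Λ` has no simple projective module. -/
def NoSimpleProjectives : Prop :=
  ∀ (M : Type u) [AddCommGroup M] [Module Λ M], IsSimpleModule Λ M → ¬ Module.Projective Λ M

/-- `Λ` is connected: no nontrivial central idempotents. -/
def IsConnectedAlg : Prop :=
  ∀ e : Λ, IsIdempotentElem e → (∀ x : Λ, e * x = x * e) → e = 0 ∨ e = 1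

section Covers

variable {Λ}
variable {P M : Type u} [AddCommGroup P] [Module Λ P] [AddCommGroup M] [Module Λ M]

/-- `p : P → M` is a projective cover: `P` projective, `p` surjective with superfluous
kernel. -/
structure IsProjCover (p : P →ₗ[Λ] M) : Prop where
  projective : Module.Projective Λ P
  surjective : Function.Surjective p
  superfluous : LinearMap.ker p ≤ modRadical Λ P

end Covers

/-- `S` is (isomorphic to) the top `M/rad M` of `M`, and is simple. -/
def IsTopOf (S M : Type u) [AddCommGroup S] [Module Λ S] [AddCommGroup M] [Module Λ M] :
    Prop :=
  IsSimpleModule Λ S ∧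
    ∃ p : M →ₗ[Λ] S, Function.Surjective p ∧ LinearMap.ker p = modRadical Λ M

/-- `S` is (isomorphic to) the socle of `M`. -/
def IsSocleOf (S M : Type u) [AddCommGroup S] [Module Λ S] [AddCommGroup M] [Module Λ M] :
    Prop :=
  ∃ i : S →ₗ[Λ] M, Function.Injective i ∧ LinearMap.range i = modSocle Λ M

/-- `IsTauOf Λ T S` : `T` is the Auslander–Reiten translate `τ S` of the simple module `S`;
for a Nakayama algebra without simple projectives this means there is a length-2 module
with top `S` and socle `T`. -/
def IsTauOf (T S : Type u) [AddCommGroup T] [Module Λ T] [AddCommGroup S] [Module Λ S] :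
    Prop :=
  IsSimpleModule Λ S ∧ IsSimpleModule Λ T ∧
    ∃ L : ModuleCat.{u} Λ, HasLength Λ L 2 ∧ IsTopOf Λ S L ∧ IsSocleOf Λ T L

/-- `GammaRel Λ S T` : `T = γ S = τ soc P(S)` in the resolution quiver. -/
def GammaRel (S T : Type u) [AddCommGroup S] [Module Λ S] [AddCommGroup T] [Module Λ T] :
    Prop :=
  IsSimpleModule Λ S ∧
    ∃ (P : ModuleCat.{u} Λ) (p : P →ₗ[Λ] S), IsProjCover p ∧
      ∃ V : ModuleCat.{u} Λ, IsSimpleModule Λ V ∧ IsSocleOf Λ V P ∧ IsTauOf Λ T V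

/-- A simple module is black if its projective dimension is at least 2, i.e. the kernel of
its projective cover is not projective. -/
def IsBlackSimple (S : Type u) [AddCommGroup S] [Module Λ S] : Prop :=
  IsSimpleModule Λ S ∧
    ∀ (P : ModuleCat.{u} Λ) (p : P →ₗ[Λ] S), IsProjCover p →
      ¬ Module.Projective Λ (LinearMap.ker p)

/-- A simple module is red if it has projective dimension exactly 1, i.e. the kernel of its
projective cover is projective. -/
def IsRedSimple (S : Type u) [AddCommGroup S] [Module Λ S] : Prop :=
  IsSimpleModule Λ S ∧
    ∃ (P : ModuleCat.{u} Λ) (p : P →ₗ[Λ] S), IsProjCover p ∧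
      Module.Projective Λ (LinearMap.ker p)

/-- A simple module is cyclically black if it lies on a cycle of the resolution quiver all
of whose vertices are black. -/
def IsCyclicallyBlack (S : Type u) [AddCommGroup S] [Module Λ S] : Prop :=
  ∃ (n : ℕ) (C : ℕ → ModuleCat.{u} Λ), 0 < n ∧
    Nonempty ((C 0 : Type u) ≃ₗ[Λ] S) ∧ Nonempty ((C n : Type u) ≃ₗ[Λ] S) ∧
    (∀ i < n, GammaRel Λ (C i) (C (i + 1))) ∧ ∀ i ≤ n, IsBlackSimple Λ (C i)

/-- An indecomposable projective module is minimal projective if its radical is not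
projective. -/
def IsMinimalProjective (P : Type u) [AddCommGroup P] [Module Λ P] : Prop :=
  Module.Projective Λ P ∧ IsIndecomposableMod Λ P ∧
    ¬ Module.Projective Λ (modRadical Λ P)

/-- `M` is Gorenstein projective: it is an image in a complete projective resolution, i.e.
an exact complex of projectives which stays exact after applying `Hom(-, Λ)`. -/
def IsGorensteinProjective (M : Type u) [AddCommGroup M] [Module Λ M] : Prop :=
  ∃ (P : ℤ → ModuleCat.{u} Λ) (d : ∀ i, P (i + 1) →ₗ[Λ] P i),
    (∀ i, Module.Projective Λ (P i)) ∧
    (∀ i, Function.Exact (d (i + 1)) (d i)) ∧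
    (∀ (i : ℤ) (φ : P (i + 1) →ₗ[Λ] Λ), φ.comp (d (i + 1)) = 0 →
      ∃ ψ : P i →ₗ[Λ] Λ, ψ.comp (d i) = φ) ∧
    Nonempty (M ≃ₗ[Λ] LinearMap.range (d 0))

/-- `M` has a finite projective resolution. -/
def HasFinitePD (M : Type u) [AddCommGroup M] [Module Λ M] : Prop :=
  ∃ (n : ℕ) (P : ℕ → ModuleCat.{u} Λ) (d : ∀ i, P (i + 1) →ₗ[Λ] P i)
      (ε : P 0 →ₗ[Λ] M),
    (∀ i, Module.Projective Λ (P i)) ∧ Function.Surjective ε ∧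
    Function.Exact (d 0) ε ∧ (∀ i, Function.Exact (d (i + 1)) (d i)) ∧
    ∀ i, n < i → Subsingleton (P i)

/-- `M` has injective dimension at most `n` (over the ring `Λ`). -/
def InjDimLE (M : Type u) [AddCommGroup M] [Module Λ M] (n : ℕ) : Prop :=
  ∃ (I : ℕ → ModuleCat.{u} Λ) (η : M →ₗ[Λ] I 0) (d : ∀ i, I i →ₗ[Λ] I (i + 1)),
    (∀ i, Module.Injective Λ (I i)) ∧ Function.Injective η ∧
    Function.Exact η (d 0) ∧ (∀ i, Function.Exact (d i) (d (i + 1))) ∧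
    ∀ i, n < i → Subsingleton (I i)

/-- `Λ` is a Gorenstein algebra: finite injective dimension as a left and right module
over itself. -/
def IsGorensteinAlg : Prop :=
  (∃ n, InjDimLE Λ Λ n) ∧ ∃ n, InjDimLE Λᵐᵒᵖ Λ n

/-- Every cycle of the resolution quiver consists of black vertices. -/
def AllCyclesBlack : Prop :=
  ∀ (n : ℕ) (C : ℕ → ModuleCat.{u} Λ), 0 < n →
    (∀ i < n, GammaRel Λ (C i) (C (i + 1))) →
    Nonempty ((C n : Type u) ≃ₗ[Λ] (C 0 : Type u)) →
    ∀ i ≤ n, IsBlackSimple Λ (C i)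

/-- Every cycle of the resolution quiver contains a red vertex. -/
def EveryCycleHasRed : Prop :=
  ∀ (n : ℕ) (C : ℕ → ModuleCat.{u} Λ), 0 < n →
    (∀ i < n, GammaRel Λ (C i) (C (i + 1))) →
    Nonempty ((C n : Type u) ≃ₗ[Λ] (C 0 : Type u)) →
    ∃ i ≤ n, IsRedSimple Λ (C i)

/-- `Λ` is CM-free: every finite-length Gorenstein projective module is projective. -/
def IsCMFree : Prop :=
  ∀ (M : Type u) [AddCommGroup M] [Module Λ M],
    (∃ n, HasLength Λ M n) → IsGorensteinProjective Λ M → Module.Projective Λ M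

/-- `Λ` has exactly `s` isomorphism classes of simple modules. -/
def SimpleCount (s : ℕ) : Prop :=
  ∃ F : Fin s → ModuleCat.{u} Λ,
    (∀ i, IsSimpleModule Λ (F i)) ∧
    (∀ i j, i ≠ j → IsEmpty ((F i : Type u) ≃ₗ[Λ] (F j : Type u))) ∧
    ∀ (S : Type u) [AddCommGroup S] [Module Λ S], IsSimpleModule Λ S →
      ∃ i, Nonempty (S ≃ₗ[Λ] (F i : Type u))

/-- Every (finite length) indecomposable projective module has length `> s`;
this is the condition `p > s`. -/
def MinProjLengthGT (s : ℕ) : Prop :=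
  ∀ (P : Type u) [AddCommGroup P] [Module Λ P],
    Module.Projective Λ P → IsIndecomposableMod Λ P →
      ∀ n, HasLength Λ P n → s < n

/-- An elementary Gorenstein projective module: nonzero, Gorenstein projective,
non-projective, and no proper nonzero factor module is Gorenstein projective. -/
def IsElementary (E : Type u) [AddCommGroup E] [Module Λ E] : Prop :=
  Nontrivial E ∧ (∃ n, HasLength Λ E n) ∧ IsGorensteinProjective Λ E ∧
    ¬ Module.Projective Λ E ∧
    ∀ N : Submodule Λ E, N ≠ ⊥ → N ≠ ⊤ → ¬ IsGorensteinProjective Λ (E ⧸ N)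

/-- `m` is the multiplicity of the simple module `S` as a composition factor of `M`. -/
def MultiplicityOf (S M : Type u) [AddCommGroup S] [Module Λ S] [AddCommGroup M]
    [Module Λ M] (m : ℕ) : Prop :=
  ∃ (n : ℕ) (c : Fin (n + 1) → Submodule Λ M),
    c 0 = ⊥ ∧ c (Fin.last n) = ⊤ ∧ (∀ i : Fin n, c i.castSucc ⋖ c i.succ) ∧
    m = Nat.card {i : Fin n //
      Nonempty ((↥(c i.succ) ⧸ (c i.castSucc).comap (c i.succ).subtype) ≃ₗ[Λ] S)}

/-- From `S`, the cycles of the resolution quiver can be reached (in a black-cycle vertex)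
in `m` steps. -/
def ReachesBlackIn (S : Type u) [AddCommGroup S] [Module Λ S] (m : ℕ) : Prop :=
  ∃ C : ℕ → ModuleCat.{u} Λ, Nonempty ((C 0 : Type u) ≃ₗ[Λ] S) ∧
    (∀ i < m, GammaRel Λ (C i) (C (i + 1))) ∧ IsCyclicallyBlack Λ (C m)

/-- `d` is the maximal distance of a vertex of the resolution quiver to the black cycles. -/
def MaxDistToBlack (d : ℕ) : Prop :=
  (∀ (S : Type u) [AddCommGroup S] [Module Λ S], IsSimpleModule Λ S →
      ∃ m ≤ d, ReachesBlackIn Λ S m) ∧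
  ∃ S : ModuleCat.{u} Λ, IsSimpleModule Λ S ∧ ∀ m < d, ¬ ReachesBlackIn Λ (S : Type u) m

section Helpers

variable {Λ}

theorem exists_coatom_of_artinian [IsArtinianRing Λ] (M : Type u) [AddCommGroup M] [Module Λ M] :
    Nontrivial M → ∃ N : Submodule Λ M, IsCoatom N := by
  refine IsSemiprimaryRing.induction Λ Λ M
    (P := fun M _ _ i ↦ Nontrivial M → ∃ N : @Submodule Λ M _ _ i, IsCoatom N) ?_ ?_
  · intro M _ _ _ _ _ _ _
    obtain ⟨m, hm, -⟩ := (eq_top_or_exists_le_coatom (⊥ : Submodule Λ M)).resolve_left bot_ne_top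
    exact ⟨m, hm⟩
  · intro M _ _ _ _ N h1 h2 _
    by_cases hN : N = ⊤
    · have e : N ≃ₗ[Λ] M := LinearEquiv.ofTop N hN
      obtain ⟨K, hK⟩ := h1 e.toEquiv.nontrivial
      exact ⟨K.map e.toLinearMap,
        (OrderIso.isCoatom_iff (Submodule.orderIsoMapComap e) K).mpr hK⟩
    · obtain ⟨K, hK⟩ := h2 (Submodule.Quotient.nontrivial_iff.mpr hN)
      exact ⟨K.comap N.mkQ, (Submodule.isCoatom_comap_iff N.mkQ_surjective).mpr hK⟩

theorem le_coatom_of_artinian [IsArtinianRing Λ] {M : Type u} [AddCommGroup M] [Module Λ M]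
    (N : Submodule Λ M) (hN : N ≠ ⊤) : ∃ K : Submodule Λ M, IsCoatom K ∧ N ≤ K := by
  obtain ⟨K, hK⟩ := exists_coatom_of_artinian (Λ := Λ) (M ⧸ N)
    (Submodule.Quotient.nontrivial_iff.mpr hN)
  refine ⟨K.comap N.mkQ, (Submodule.isCoatom_comap_iff N.mkQ_surjective).mpr hK, ?_⟩
  exact Submodule.le_comap_mkQ N K

theorem hasLength_iff {M : Type u} [AddCommGroup M] [Module Λ M] :
    (∃ n, HasLength Λ M n) ↔ IsFiniteLength Λ M := by
  rw [isFiniteLength_iff_exists_compositionSeries]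
  constructor
  · rintro ⟨n, c, h0, h1, h2⟩
    exact ⟨⟨n, c, h2⟩, h0, h1⟩
  · rintro ⟨s, h0, h1⟩
    exact ⟨s.length, s.toFun, h0, h1, s.step⟩

section
variable {P M : Type u} [AddCommGroup P] [Module Λ P] [AddCommGroup M] [Module Λ M]

theorem ker_le_coatom {p : P →ₗ[Λ] M} (hp : IsProjCover p) {K : Submodule Λ P} (hK : IsCoatom K) :
    LinearMap.ker p ≤ K := hp.superfluous.trans (sInf_le hK)

theorem cover_finite [IsArtinianRing Λ] [Module.Finite Λ M] {p : P →ₗ[Λ] M} (hp : IsProjCover p) :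
    Module.Finite Λ P := by
  obtain ⟨F, hF, hFm⟩ : ∃ F : Submodule Λ P, F.FG ∧ F.map p = ⊤ := by
    obtain ⟨s, hs⟩ := (Module.Finite.fg_top : (⊤ : Submodule Λ M).FG)
    refine ⟨Submodule.span Λ (Set.image (Function.surjInv hp.surjective) (s : Set M)),
      Submodule.fg_span (s.finite_toSet.image _), ?_⟩
    rw [Submodule.map_span, ← Set.image_comp,
      (Function.rightInverse_surjInv hp.surjective).comp_eq_id, Set.image_id, hs]
  refine ⟨?_⟩
  by_contra hne
  have : F ≠ ⊤ := fun h => hne (h ▸ hF)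
  obtain ⟨K, hK, hFK⟩ := le_coatom_of_artinian F this
  apply hK.1
  rw [← Submodule.comap_map_eq_self (ker_le_coatom hp hK), eq_top_iff,
    ← Submodule.map_le_iff_le_comap]
  exact le_top.trans (hFm.ge.trans (Submodule.map_mono hFK))

theorem coatom_unique (hu : IsUniserialMod Λ M) {A B : Submodule Λ M} (hA : IsCoatom A)
    (hB : IsCoatom B) : A = B := by
  rcases hu A B with h | h
  · rcases hA.le_iff.mp h with h' | h'
    · exact absurd h' hB.1
    · exact h'.symm
  · rcases hB.le_iff.mp h with h' | h'
    · exact absurd h' hA.1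
    · exact h'

theorem atom_unique (hu : IsUniserialMod Λ M) {A B : Submodule Λ M} (hA : IsAtom A)
    (hB : IsAtom B) : A = B := by
  rcases hu A B with h | h
  · rcases hB.le_iff.mp h with h' | h'
    · exact absurd h' hA.1
    · exact h'
  · rcases hA.le_iff.mp h with h' | h'
    · exact absurd h' hB.1
    · exact h'.symm

theorem radical_eq (hu : IsUniserialMod Λ M) {A : Submodule Λ M} (hA : IsCoatom A) :
    modRadical Λ M = A :=
  le_antisymm (sInf_le hA) (le_sInf fun _ hB => (coatom_unique hu hA hB).le)

theorem socle_eq (hu : IsUniserialMod Λ M) {A : Submodule Λ M} (hA : IsAtom A) :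
    modSocle Λ M = A :=
  le_antisymm (sSup_le fun _ hB => (atom_unique hu hB hA).le) (le_sSup hA)

theorem uniserial_of_injective (hu : IsUniserialMod Λ M) {f : P →ₗ[Λ] M}
    (hf : Function.Injective f) : IsUniserialMod Λ P := fun N N' =>
  (hu (N.map f) (N'.map f)).imp (Submodule.map_le_map_iff_of_injective hf _ _).mp
    (Submodule.map_le_map_iff_of_injective hf _ _).mp

theorem uniserial_of_surjective (hu : IsUniserialMod Λ P) {f : P →ₗ[Λ] M}
    (hf : Function.Surjective f) : IsUniserialMod Λ M := fun N N' =>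
  (hu (N.comap f) (N'.comap f)).imp (Submodule.comap_le_comap_iff_of_surjective hf).mp
    (Submodule.comap_le_comap_iff_of_surjective hf).mp

theorem finiteLength_of_finite [IsArtinianRing Λ] [Module.Finite Λ P] : IsFiniteLength Λ P :=
  isFiniteLength_iff_isNoetherian_isArtinian.mpr ⟨inferInstance, inferInstance⟩

theorem cover_coatom {p : P →ₗ[Λ] M} (hp : IsProjCover p) {K : Submodule Λ P} (hK : IsCoatom K) :
    IsCoatom (K.map p) := by
  rw [← Submodule.isCoatom_comap_iff hp.surjective,
    Submodule.comap_map_eq_self (ker_le_coatom hp hK)]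
  exact hK

theorem cover_uniserial [IsNakayama Λ] [Module.Finite Λ M] (hu : IsUniserialMod Λ M)
    [Nontrivial M] {p : P →ₗ[Λ] M} (hp : IsProjCover p) : IsUniserialMod Λ P := by
  have : IsArtinianRing Λ := IsNakayama.artinian
  have := cover_finite hp
  refine IsNakayama.serial P (hasLength_iff.mpr finiteLength_of_finite)
    ⟨hp.surjective.nontrivial, fun N N' h => ?_⟩
  by_contra! hne
  have hN : N ≠ ⊤ := fun e => hne.2 (by simpa [e] using h.inf_eq_bot)
  have hN' : N' ≠ ⊤ := fun e => hne.1 (by simpa [e] using h.inf_eq_bot)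
  obtain ⟨K, hK, hNK⟩ := le_coatom_of_artinian N hN
  obtain ⟨K', hK', hNK'⟩ := le_coatom_of_artinian N' hN'
  have e : K = K' := by
    rw [← Submodule.comap_map_eq_self (ker_le_coatom hp hK),
      ← Submodule.comap_map_eq_self (ker_le_coatom hp hK'),
      coatom_unique hu (cover_coatom hp hK) (cover_coatom hp hK')]
  apply hK.1
  rw [eq_top_iff, ← h.sup_eq_top]
  exact sup_le hNK (hNK'.trans e.ge)

end

/-- A uniserial extension of simples exhibits `T` as `τ V`. -/
theorem isTauOf_of_exact {T E V : Type u} [AddCommGroup T] [Module Λ T] [AddCommGroup E]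
    [Module Λ E] [AddCommGroup V] [Module Λ V] (hT : IsSimpleModule Λ T) (hV : IsSimpleModule Λ V)
    (hu : IsUniserialMod Λ E) (f : T →ₗ[Λ] E) (g : E →ₗ[Λ] V) (hf : Function.Injective f)
    (hg : Function.Surjective g) (hfg : LinearMap.range f = LinearMap.ker g) :
    IsTauOf Λ T V := by
  have hco : IsCoatom (LinearMap.ker g) := LinearMap.isCoatom_ker_of_surjective hg
  have hat : IsAtom (LinearMap.range f) := by
    rw [← isSimpleModule_iff_isAtom]
    exact IsSimpleModule.congr (LinearEquiv.ofInjective f hf).symm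
  refine ⟨hV, hT, ModuleCat.of Λ E, ?_, ⟨hV, g, hg, (radical_eq hu hco).symm⟩,
    ⟨f, hf, (socle_eq hu hat).symm⟩⟩
  refine ⟨![⊥, LinearMap.range f, ⊤], rfl, rfl, ?_⟩
  intro i
  fin_cases i
  · exact bot_covBy_iff.mpr hat
  · exact covBy_top_iff.mpr (hfg ▸ hco)

end Helpers

/-- For an indecomposable finite-length module `M` over a Nakayama algebra without simple
projectives: either `pd M ≤ 1` and `Ω²(M) = 0`, or `top Ω²(M) = γ(top M)`, where
`γ S = τ soc P(S)`.  Syzygies are taken with respect to projective covers. -/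
theorem top_second_syzygy [IsNakayama Λ] (h0 : NoSimpleProjectives Λ)
    (M P0 P1 : Type u) [AddCommGroup M] [Module Λ M] [AddCommGroup P0] [Module Λ P0]
    [AddCommGroup P1] [Module Λ P1]
    (hfl : ∃ n, HasLength Λ M n) (hind : IsIndecomposableMod Λ M)
    (p0 : P0 →ₗ[Λ] M) (hp0 : IsProjCover p0)
    (p1 : P1 →ₗ[Λ] LinearMap.ker p0) (hp1 : IsProjCover p1) :
    (Module.Projective Λ (LinearMap.ker p0) ∧ LinearMap.ker p1 = ⊥) ∨
    ∀ (S T : Type u) [AddCommGroup S] [Module Λ S] [AddCommGroup T] [Module Λ T],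
      IsTopOf Λ S M → IsTopOf Λ T (LinearMap.ker p1) → GammaRel Λ S T := by
  have : IsArtinianRing Λ := IsNakayama.artinian
  have huM : IsUniserialMod Λ M := IsNakayama.serial M hfl hind
  have : Nontrivial M := hind.1
  have hM := isFiniteLength_iff_isNoetherian_isArtinian.mp (hasLength_iff.mp hfl)
  have := hM.1
  have huP0 := cover_uniserial huM hp0
  have := cover_finite hp0
  have : Nontrivial P0 := hp0.surjective.nontrivial
  have := cover_finite hp1
  by_cases hL : LinearMap.ker p1 = ⊥
  · left
    have := hp1.projective
    exact ⟨Module.Projective.of_equiv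
      (LinearEquiv.ofBijective p1 ⟨LinearMap.ker_eq_bot.mp hL, hp1.surjective⟩), hL⟩
  right
  intro S T _ _ _ _ hS hT
  obtain ⟨hSs, q, hq, hqk⟩ := hS
  obtain ⟨hTs, t, ht, htk⟩ := hT
  have hKnt : Nontrivial (LinearMap.ker p0) := by
    by_contra hK
    rw [not_nontrivial_iff_subsingleton] at hK
    have hP1 : Nontrivial P1 := by
      by_contra h
      rw [not_nontrivial_iff_subsingleton] at h
      exact hL (Subsingleton.elim _ _)
    obtain ⟨N, hN⟩ := exists_coatom_of_artinian (Λ := Λ) P1 hP1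
    exact hN.1 (eq_top_iff.mpr fun x _ => ker_le_coatom hp1 hN (Subsingleton.elim _ _))
  have huK : IsUniserialMod Λ (LinearMap.ker p0) :=
    uniserial_of_injective huP0 (LinearMap.ker p0).injective_subtype
  have huP1 := cover_uniserial huK hp1
  -- the socle of `P0`
  obtain ⟨V, hV, hVK⟩ : ∃ V : Submodule Λ P0, IsAtom V ∧ V ≤ LinearMap.ker p0 :=
    (eq_bot_or_exists_atom_le (LinearMap.ker p0)).resolve_left
      ((Submodule.nontrivial_iff_ne_bot).mp hKnt)
  have hVs : IsSimpleModule Λ V := isSimpleModule_iff_isAtom.mpr hV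
  refine ⟨hSs, ModuleCat.of Λ P0, q.comp p0, ⟨hp0.projective, hq.comp hp0.surjective, ?_⟩,
    ModuleCat.of Λ V, hVs, ⟨V.subtype, V.injective_subtype, ?_⟩, ?_⟩
  · refine le_sInf fun N hN x hx => ?_
    have hx' : p0 x ∈ modRadical Λ M := by rw [← hqk]; exact hx
    have := (sInf_le (cover_coatom hp0 hN) : modRadical Λ M ≤ _) hx'
    rw [← Submodule.mem_comap, Submodule.comap_map_eq_self (ker_le_coatom hp0 hN)] at this
    exact this
  · rw [Submodule.range_subtype]
    exact (socle_eq huP0 hV).symm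
  -- the length two module
  let r : P1 →ₗ[Λ] P0 := (LinearMap.ker p0).subtype.comp p1
  let L' : Submodule Λ P1 := V.comap r
  have hLL' : LinearMap.ker p1 ≤ L' := fun x hx => by
    have : p1 x = 0 := hx
    simp [L', r, this]
  let ι : LinearMap.ker p1 →ₗ[Λ] L' := Submodule.inclusion hLL'
  have hι : Function.Injective ι := Submodule.inclusion_injective hLL'
  let R : Submodule Λ L' := (LinearMap.ker t).map ι
  let g0 : L' →ₗ[Λ] V := r.restrict (fun x hx => hx)
  have hg0 : Function.Surjective g0 := by
    rintro ⟨v, hv⟩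
    obtain ⟨x, hx⟩ := hp1.surjective ⟨v, hVK hv⟩
    have hrx : r x = v := by simp [r, hx]
    exact ⟨⟨x, by simpa [L', hrx] using hv⟩, Subtype.ext hrx⟩
  have hg0k : LinearMap.ker g0 = LinearMap.range ι := by
    ext x
    constructor
    · intro hx
      have h1 : r x.1 = 0 := congrArg Subtype.val (show g0 x = 0 from hx)
      have h2 : p1 x.1 = 0 := Subtype.ext h1
      exact ⟨⟨x.1, h2⟩, Subtype.ext rfl⟩
    · rintro ⟨y, rfl⟩
      have : p1 y.1 = 0 := y.2
      exact Subtype.ext (show r y.1 = 0 by simp [r, this])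
  have hR : R ≤ LinearMap.ker g0 := hg0k ▸ LinearMap.map_le_range
  let g : (L' ⧸ R) →ₗ[Λ] V := R.liftQ g0 hR
  have hg : Function.Surjective g := fun v => by
    obtain ⟨x, hx⟩ := hg0 v
    exact ⟨R.mkQ x, by simpa [g] using hx⟩
  let f0 : LinearMap.ker p1 →ₗ[Λ] L' ⧸ R := R.mkQ.comp ι
  have hf0 : LinearMap.ker f0 = LinearMap.ker t := by
    rw [LinearMap.ker_comp, Submodule.ker_mkQ]
    exact Submodule.comap_map_eq_of_injective hι _
  let f1 : (LinearMap.ker p1 ⧸ LinearMap.ker t) →ₗ[Λ] L' ⧸ R :=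
    (LinearMap.ker t).liftQ f0 hf0.ge
  have hf1 : Function.Injective f1 := by
    rw [← LinearMap.ker_eq_bot]
    exact Submodule.ker_liftQ_eq_bot' _ _ hf0.symm
  let e : (LinearMap.ker p1 ⧸ LinearMap.ker t) ≃ₗ[Λ] T := t.quotKerEquivOfSurjective ht
  have huE : IsUniserialMod Λ (L' ⧸ R) :=
    uniserial_of_surjective (uniserial_of_injective huP1 L'.injective_subtype) R.mkQ_surjective
  refine isTauOf_of_exact hTs hVs huE (f1.comp e.symm.toLinearMap) g
    (hf1.comp e.symm.injective) hg ?_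
  rw [LinearMap.range_comp_of_range_eq_top _ (LinearEquiv.range _), Submodule.range_liftQ,
    Submodule.ker_liftQ, hg0k, LinearMap.range_comp]
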